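/- Let F be a field with exactly 3 elements, let η ∈ {1, -1} ⊆ F, and let M be an element of the symplectic group Sp_4(F) whose minimal polynomial equals (X^2 + 1)·(X - η)^2 (such M is automatically cyclic since this polynomial has degree 4). Then M is not a product of four involutions of Sp_4(F): there do not exist A1, A2, A3, A4 in Sp_4(F) with Ai^2 = 1 for each i and M = A1*A2*A3*A4. -/

import Mathlib

namespace SpF3
abbrev K := ZMod 3
abbrev Mat := Matrix (Fin 2 ⊕ Fin 2) (Fin 2 ⊕ Fin 2) K

/-- self-adjoint traceless matrices -/
def S (p q r y z : K) : Mat :=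
  Matrix.fromBlocks !![p, q; r, -p] !![0, y; -y, 0] !![0, z; -z, 0] !![p, r; q, -p]

def D : Mat := S 1 0 0 0 0

def dg (a b c d a' b' c' d' : K) : Mat :=
  Matrix.fromBlocks !![a, 0; 0, a'] !![b, 0; 0, b'] !![c, 0; 0, c'] !![d, 0; 0, d']

def off (a b c d a' b' c' d' : K) : Mat :=
  Matrix.fromBlocks !![0, a; a', 0] !![0, b; b', 0] !![0, c; c', 0] !![0, d; d', 0]

def chi (a b c d : K) : K := (a + d) * c - b * d * (c ^ 2 - 1)

theorem chi_mul : ∀ a b c d : K, a * d - b * c = 1 → ∀ a' b' c' d' : K, a' * d' - b' * c' = 1 →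
    chi (a * a' + b * c') (a * b' + b * d') (c * a' + d * c') (c * b' + d * d')
      = chi a b c d + chi a' b' c' d' := by
  unfold chi
  set_option maxRecDepth 100000 in decide

theorem chi_inv : ∀ a b c d : K, a * d - b * c = 1 → chi a b c d + chi d (-b) (-c) a = 0 := by
  unfold chi
  set_option maxRecDepth 100000 in decide

def InK (A : Mat) : Prop := ∃ a b c d a' b' c' d' : K, a * d - b * c = 1 ∧ a' * d' - b' * c' = 1 ∧
  chi a b c d + chi a' b' c' d' = 0 ∧ (A = dg a b c d a' b' c' d' ∨ A = off a b c d a' b' c' d')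

theorem dg_dg (a b c d a' b' c' d' x y z w x' y' z' w' : K) :
    dg a b c d a' b' c' d' * dg x y z w x' y' z' w' =
    dg (a*x+b*z) (a*y+b*w) (c*x+d*z) (c*y+d*w) (a'*x'+b'*z') (a'*y'+b'*w') (c'*x'+d'*z') (c'*y'+d'*w') := by
  simp [dg, Matrix.fromBlocks_multiply]
theorem dg_off (a b c d a' b' c' d' x y z w x' y' z' w' : K) :
    dg a b c d a' b' c' d' * off x y z w x' y' z' w' =
    off (a*x+b*z) (a*y+b*w) (c*x+d*z) (c*y+d*w) (a'*x'+b'*z') (a'*y'+b'*w') (c'*x'+d'*z') (c'*y'+d'*w') := by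
  simp [dg, off, Matrix.fromBlocks_multiply]
theorem off_dg (a b c d a' b' c' d' x' y' z' w' x y z w : K) :
    off a b c d a' b' c' d' * dg x' y' z' w' x y z w =
    off (a*x+b*z) (a*y+b*w) (c*x+d*z) (c*y+d*w) (a'*x'+b'*z') (a'*y'+b'*w') (c'*x'+d'*z') (c'*y'+d'*w') := by
  simp [dg, off, Matrix.fromBlocks_multiply]
theorem off_off (a b c d a' b' c' d' x' y' z' w' x y z w : K) :
    off a b c d a' b' c' d' * off x' y' z' w' x y z w =
    dg (a*x+b*z) (a*y+b*w) (c*x+d*z) (c*y+d*w) (a'*x'+b'*z') (a'*y'+b'*w') (c'*x'+d'*z') (c'*y'+d'*w') := by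
  simp [dg, off, Matrix.fromBlocks_multiply]

theorem InK.mul {A B : Mat} (hA : InK A) (hB : InK B) : InK (A * B) := by
  obtain ⟨a, b, c, d, a', b', c', d', h1, h2, h3, h4⟩ := hA
  obtain ⟨x, y, z, w, x', y', z', w', k1, k2, k3, k4⟩ := hB
  have e1 := chi_mul _ _ _ _ h1 _ _ _ _ k1
  have e2 := chi_mul _ _ _ _ h2 _ _ _ _ k2
  have e3 := chi_mul _ _ _ _ h1 _ _ _ _ k2
  have e4 := chi_mul _ _ _ _ h2 _ _ _ _ k1
  rcases h4 with rfl | rfl <;> rcases k4 with rfl | rfl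
  · rw [dg_dg]
    exact ⟨_, _, _, _, _, _, _, _, by grind, by grind, by rw [e1, e2]; grind, Or.inl rfl⟩
  · rw [dg_off]
    exact ⟨_, _, _, _, _, _, _, _, by grind, by grind, by rw [e1, e2]; grind, Or.inr rfl⟩
  · rw [off_dg]
    exact ⟨_, _, _, _, _, _, _, _, by grind, by grind, by rw [e3, e4]; grind, Or.inr rfl⟩
  · rw [off_off]
    exact ⟨_, _, _, _, _, _, _, _, by grind, by grind, by rw [e3, e4]; grind, Or.inl rfl⟩

theorem one_dg : (1 : Mat) = dg 1 0 0 1 1 0 0 1 := by decide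
theorem neg_one_dg : (-1 : Mat) = dg (-1) 0 0 (-1) (-1) 0 0 (-1) := by decide
theorem D_dg : D = dg 1 0 0 1 (-1) 0 0 (-1) := by decide
theorem neg_D_dg : -D = dg (-1) 0 0 (-1) 1 0 0 1 := by decide

theorem dg_inj {a b c d a' b' c' d' x y z w x' y' z' w' : K}
    (h : dg a b c d a' b' c' d' = dg x y z w x' y' z' w') :
    (a = x ∧ b = y ∧ c = z ∧ d = w) ∧ (a' = x' ∧ b' = y' ∧ c' = z' ∧ d' = w') := by
  simp only [dg, Matrix.fromBlocks_inj] at h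
  obtain ⟨h1, h2, h3, h4⟩ := h
  have f := fun i => congrFun (congrFun h1 i) i
  have f2 := fun i => congrFun (congrFun h2 i) i
  have f3 := fun i => congrFun (congrFun h3 i) i
  have f4 := fun i => congrFun (congrFun h4 i) i
  simp [Fin.forall_fin_two] at f f2 f3 f4
  tauto

/-- classification of involutions -/
theorem self_adj (A : Mat) (h : A.transpose * Matrix.J (Fin 2) K = Matrix.J (Fin 2) K * A) :
    ∃ t p q r y z : K, A = t • 1 + S p q r y z := by
  have e := fun i j => congrFun (congrFun h i) j
  simp [Matrix.mul_apply, Matrix.J, Fintype.sum_sum_type, Fin.forall_fin_two, Matrix.one_apply] at e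
  refine ⟨-(A (.inl 0) (.inl 0) + A (.inl 1) (.inl 1)), -(A (.inl 0) (.inl 0) - A (.inl 1) (.inl 1)),
    A (.inl 0) (.inl 1), A (.inl 1) (.inl 0), A (.inl 0) (.inr 1), A (.inr 0) (.inl 1), ?_⟩
  have h3 : (3 : K) = 0 := by decide
  have e1 : ∀ a d : K, a = -(a + d) + -(a - d) := fun a d => by linear_combination a * h3
  have e2 : ∀ a d : K, d = -(a + d) - -(a - d) := fun a d => by linear_combination d * h3
  clear h3
  ext i j
  fin_cases i <;> fin_cases j <;> simp [S] <;> grind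

def B (p q r y z p' q' r' y' z' : K) : K := 2*p*p'+q*r'+r*q'-y*z'-z*y'

theorem S_anti (p q r y z p' q' r' y' z' : K) :
    S p q r y z * S p' q' r' y' z' + S p' q' r' y' z' * S p q r y z =
      B p q r y z p' q' r' y' z' • 1 := by
  ext i j
  fin_cases i <;> fin_cases j <;>
    simp [S, B, Matrix.fromBlocks_multiply] <;> ring

theorem S_sq (p q r y z : K) :
    S p q r y z * S p q r y z = (p^2+q*r-y*z) • 1 := by
  ext i j
  fin_cases i <;> fin_cases j <;>
    simp [S, Matrix.fromBlocks_multiply] <;> ring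

theorem S_self (p q r y z : K) :
    (S p q r y z).transpose * Matrix.J (Fin 2) K = Matrix.J (Fin 2) K * S p q r y z := by
  ext i j
  fin_cases i <;> fin_cases j <;>
    simp [S, Matrix.J, Matrix.mul_apply, Fintype.sum_sum_type, Matrix.one_apply]

theorem inv_class (A : Mat) (h : A.transpose * Matrix.J (Fin 2) K = Matrix.J (Fin 2) K * A)
    (h2 : A * A = 1) : A = 1 ∨ A = -1 ∨ ∃ p q r y z : K, A = S p q r y z ∧ p^2+q*r-y*z = 1 := by
  obtain ⟨t, p, q, r, y, z, rfl⟩ := self_adj A h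
  have e : (t^2 + (p^2+q*r-y*z)) • (1:Mat) + (2 * t) • S p q r y z = 1 := by
    refine Eq.trans ?_ h2
    rw [add_mul, mul_add, mul_add, S_sq]
    simp only [smul_mul_assoc, mul_smul_comm, one_mul, mul_one]
    module
  have f := fun i j => congrFun (congrFun e i) j
  simp [S, Matrix.one_apply, Fin.forall_fin_two] at f
  by_cases ht : t = 0
  · subst ht
    refine Or.inr (Or.inr ⟨p, q, r, y, z, by simp, ?_⟩)
    grind
  · have h20 : (2:K) ≠ 0 := by decide
    have hp : p = 0 := by
      have : 2 * (2 * t * p) = 0 := by linear_combination f.1.1.1.1 - f.1.2.1.2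
      grind
    have hq : q = 0 := by grind
    have hr : r = 0 := by grind
    have hy : y = 0 := by grind
    have hz : z = 0 := by grind
    subst hp hq hr hy hz
    have : t = 1 ∨ t = -1 := by revert t; decide
    have h0 : S 0 0 0 0 0 = 0 := by decide
    rcases this with rfl | rfl
    · left; simp [h0]
    · right; left; simp [h0]

def SV (w : Fin 5 → K) : Mat := S (w 0) (w 1) (w 2) (w 3) (w 4)

def IC (A : Mat) : Prop := A = 1 ∨ A = -1 ∨ ∃ p q r y z : K, A = S p q r y z ∧ p^2+q*r-y*z = 1

theorem step1 (A : Mat) (h : IC A) : ∃ x : Fin 5 → K, ∀ w : Fin 5 → K, x ⬝ᵥ w = 0 →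
    A = 1 ∨ A = -1 ∨ SV w * A = -(A * SV w) := by
  rcases h with rfl | rfl | ⟨p, q, r, y, z, rfl, -⟩
  · exact ⟨0, by simp⟩
  · exact ⟨0, by simp⟩
  · refine ⟨![2*p, r, q, -z, -y], fun w hw => Or.inr (Or.inr ?_)⟩
    rw [eq_neg_iff_add_eq_zero, SV, S_anti]
    have : B (w 0) (w 1) (w 2) (w 3) (w 4) p q r y z = 0 := by
      rw [← hw, B]
      simp [dotProduct, Fin.sum_univ_five]
      ring
    rw [this, zero_smul]

theorem exists_w (x₁ x₂ x₃ x₄ : Fin 5 → K) : ∃ w : Fin 5 → K, w ≠ 0 ∧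
    x₁ ⬝ᵥ w = 0 ∧ x₂ ⬝ᵥ w = 0 ∧ x₃ ⬝ᵥ w = 0 ∧ x₄ ⬝ᵥ w = 0 := by
  have hk := LinearMap.ker_ne_bot_of_finrank_lt
    (f := Matrix.mulVecLin (Matrix.of ![x₁, x₂, x₃, x₄])) (by simp)
  obtain ⟨w, hw, hw0⟩ := Submodule.exists_mem_ne_zero_of_ne_bot hk
  have e := fun i => congrFun (LinearMap.mem_ker.1 hw) i
  refine ⟨w, hw0, ?_, ?_, ?_, ?_⟩
  · simpa [Matrix.mulVec] using e 0
  · simpa [Matrix.mulVec] using e 1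
  · simpa [Matrix.mulVec] using e 2
  · simpa [Matrix.mulVec] using e 3

theorem comm_D (p q r y z : K) (h : S p q r y z * D = D * S p q r y z) :
    q = 0 ∧ r = 0 ∧ y = 0 ∧ z = 0 := by
  have f := fun i j => congrFun (congrFun h i) j
  simp [S, D, Matrix.fromBlocks_multiply, Fin.forall_fin_two] at f
  have g : ∀ a : K, -a = a → a = 0 := by decide
  have g' : ∀ a : K, a = -a → a = 0 := by decide
  grind

theorem anti_D (p q r y z : K) (h : D * S p q r y z = -(S p q r y z * D)) : p = 0 := by
  have f := congrFun (congrFun h (.inl 0)) (.inl 0)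
  simp [S, D, Matrix.fromBlocks_multiply] at f
  have g : ∀ a : K, a = -a → a = 0 := by decide
  exact g _ f

theorem IC.inK {A : Mat} (h : IC A) (h' : A = 1 ∨ A = -1 ∨ D * A = -(A * D)) : InK A := by
  have h1 : InK 1 := ⟨1, 0, 0, 1, 1, 0, 0, 1, by decide, by decide, by decide, Or.inl one_dg⟩
  have h2 : InK (-1) := ⟨-1, 0, 0, -1, -1, 0, 0, -1, by decide, by decide, by decide,
    Or.inl neg_one_dg⟩
  rcases h with rfl | rfl | ⟨p, q, r, y, z, rfl, hq⟩
  · exact h1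
  · exact h2
  · rcases h' with h' | h' | h'
    · rwa [h']
    · rwa [h']
    · have := anti_D _ _ _ _ _ h'
      subst this
      have hd : q * r - y * z = 1 := by rw [← hq]; ring
      refine ⟨q, y, z, r, r, -y, -z, q, hd, by rw [← hd]; ring, chi_inv _ _ _ _ hd, Or.inr ?_⟩
      simp [S, off]

def m4 (x y : K × K × K × K) : K × K × K × K :=
  (x.1*y.1+x.2.1*y.2.2.1, x.1*y.2.1+x.2.1*y.2.2.2,
   x.2.2.1*y.1+x.2.2.2*y.2.2.1, x.2.2.1*y.2.1+x.2.2.2*y.2.2.2)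

theorem fin1 : ∀ a b c d : K, a * d - b * c = 1 →
    m4 (m4 (m4 (a,b,c,d) (a,b,c,d)) (m4 (a,b,c,d) (a,b,c,d))) (m4 (a,b,c,d) (a,b,c,d))
      = (-1,0,0,-1) → chi a b c d = 0 := by
  unfold chi m4
  set_option maxRecDepth 100000 in decide

theorem fin2 : ∀ a b c d : K, a * d - b * c = 1 → chi a b c d = 0 →
    m4 (m4 (a,b,c,d) (a,b,c,d)) (m4 (a,b,c,d) (a,b,c,d)) = (1,0,0,1) := by
  unfold chi m4
  set_option maxRecDepth 100000 in decide

def dg' (x y : K × K × K × K) : Mat := dg x.1 x.2.1 x.2.2.1 x.2.2.2 y.1 y.2.1 y.2.2.1 y.2.2.2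

theorem dg'_mul (x y x' y' : K × K × K × K) : dg' x y * dg' x' y' = dg' (m4 x x') (m4 y y') :=
  dg_dg _ _ _ _ _ _ _ _ _ _ _ _ _ _ _ _

theorem dg'_inj {x y x' y' : K × K × K × K} (h : dg' x y = dg' x' y') : x = x' ∧ y = y' := by
  have := dg_inj h
  simp only [Prod.ext_iff]
  tauto

theorem off_D (a b c d a' b' c' d' : K)
    (h : off a b c d a' b' c' d' * D = D * off a b c d a' b' c' d') : a = 0 ∧ b = 0 := by
  have f1 := congrFun (congrFun h (.inl 0)) (.inl 1)
  have f2 := congrFun (congrFun h (.inl 0)) (.inr 1)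
  simp [S, D, off, Matrix.fromBlocks_multiply] at f1 f2
  have g : ∀ a : K, -a = a → a = 0 := by decide
  exact ⟨g _ f1, g _ f2⟩

theorem final {M : Mat} (hM : InK M) (h6 : M ^ 6 = D ∨ M ^ 6 = -D) : M ^ 4 = 1 := by
  have hc : M * D = D * M := by
    rcases h6 with h | h
    · rw [← h, ← pow_succ, ← pow_succ']
    · rw [← neg_neg D, ← h, mul_neg, neg_mul, ← pow_succ, ← pow_succ']
  obtain ⟨a, b, c, d, a', b', c', d', h1, h2, h3, h4⟩ := hM
  rcases h4 with h4 | h4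
  · have e : M = dg' (a,b,c,d) (a',b',c',d') := h4
    have e4 : M ^ 4 = (M * M) * (M * M) := by noncomm_ring
    have e6 : M ^ 6 = (M * M) * (M * M) * (M * M) := by noncomm_ring
    have hD : D = dg' (1,0,0,1) (-1,0,0,-1) := D_dg
    have hD' : -D = dg' (-1,0,0,-1) (1,0,0,1) := neg_D_dg
    have key : chi a b c d = 0 ∧ chi a' b' c' d' = 0 := by
      rcases h6 with h | h
      · rw [e6, e, dg'_mul, dg'_mul, dg'_mul, hD] at h
        have := fin1 _ _ _ _ h2 (dg'_inj h).2
        exact ⟨by rw [this, add_zero] at h3; exact h3, this⟩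
      · rw [e6, e, dg'_mul, dg'_mul, dg'_mul, hD'] at h
        have := fin1 _ _ _ _ h1 (dg'_inj h).1
        exact ⟨this, by rw [this, zero_add] at h3; exact h3⟩
    rw [e4, e, dg'_mul, dg'_mul, fin2 _ _ _ _ h1 key.1, fin2 _ _ _ _ h2 key.2]
    exact one_dg.symm
  · rw [h4] at hc
    obtain ⟨rfl, rfl⟩ := off_D _ _ _ _ _ _ _ _ hc
    simp at h1

theorem anti_pm {W A : Mat} (h : A = 1 ∨ A = -1 ∨ W * A = -(A * W)) :
    W * A = A * W ∨ W * A = -(A * W) := by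
  rcases h with rfl | rfl | h <;> simp_all

theorem pm_mul {W A B : Mat} (h : W * A = A * W ∨ W * A = -(A * W))
    (h' : W * B = B * W ∨ W * B = -(B * W)) :
    W * (A * B) = A * B * W ∨ W * (A * B) = -(A * B * W) := by
  rw [← mul_assoc]
  rcases h with h | h <;> rcases h' with h' | h' <;>
    simp [h, h', mul_assoc]

theorem core1 {A₁ A₂ A₃ A₄ : Mat} (h₁ : IC A₁) (h₂ : IC A₂) (h₃ : IC A₃) (h₄ : IC A₄)
    (h6 : (A₁ * A₂ * A₃ * A₄) ^ 6 = D ∨ (A₁ * A₂ * A₃ * A₄) ^ 6 = -D) :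
    (A₁ * A₂ * A₃ * A₄) ^ 4 = 1 := by
  obtain ⟨x₁, hx₁⟩ := step1 _ h₁
  obtain ⟨x₂, hx₂⟩ := step1 _ h₂
  obtain ⟨x₃, hx₃⟩ := step1 _ h₃
  obtain ⟨x₄, hx₄⟩ := step1 _ h₄
  obtain ⟨w, hw0, hw₁, hw₂, hw₃, hw₄⟩ := exists_w x₁ x₂ x₃ x₄
  have k₁ := hx₁ w hw₁
  have k₂ := hx₂ w hw₂
  have k₃ := hx₃ w hw₃
  have k₄ := hx₄ w hw₄
  have hM := pm_mul (pm_mul (pm_mul (anti_pm k₁) (anti_pm k₂)) (anti_pm k₃)) (anti_pm k₄)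
  have hD : SV w * D = D * SV w := by
    have hc2 : Commute (SV w) ((A₁ * A₂ * A₃ * A₄) ^ 2) := by
      generalize A₁ * A₂ * A₃ * A₄ = M at *
      rw [commute_iff_eq, pow_two, ← mul_assoc]
      rcases hM with h | h <;> simp [h, mul_assoc]
    have hc6 := hc2.pow_right 3
    rw [← pow_mul] at hc6
    rcases h6 with h | h
    · rw [h] at hc6; exact hc6
    · rw [h] at hc6; simpa using hc6.eq
  obtain ⟨e1, e2, e3, e4⟩ := comm_D _ _ _ _ _ hD
  have hp : w 0 ≠ 0 := by
    intro hp
    apply hw0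
    funext i
    fin_cases i <;> assumption
  have hSV : SV w = w 0 • D := by
    rw [SV, e1, e2, e3, e4]; simp [D, S, Matrix.fromBlocks_smul]
  have cv : ∀ A : Mat, (A = 1 ∨ A = -1 ∨ SV w * A = -(A * SV w)) →
      (A = 1 ∨ A = -1 ∨ D * A = -(A * D)) := by
    rintro A (h | h | h)
    · exact Or.inl h
    · exact Or.inr (Or.inl h)
    · refine Or.inr (Or.inr ?_)
      rw [hSV, smul_mul_assoc, mul_smul_comm, ← smul_neg] at h
      exact smul_right_injective _ hp h
  exact final ((((h₁.inK (cv _ k₁)).mul (h₂.inK (cv _ k₂))).mul (h₃.inK (cv _ k₃))).mul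
    (h₄.inK (cv _ k₄))) h6

def SA (A : Mat) : Prop := A.transpose * Matrix.J (Fin 2) K = Matrix.J (Fin 2) K * A

theorem SA.conj {W A : Mat} (hW : SA W) (hA : SA A) : SA (W * A * W) := by
  unfold SA at *
  rw [Matrix.transpose_mul, Matrix.transpose_mul, mul_assoc, mul_assoc, hW,
    ← mul_assoc A.transpose, hA, ← mul_assoc, ← mul_assoc, hW, mul_assoc, mul_assoc, mul_assoc]

theorem core2 {A₁ A₂ A₃ A₄ M : Mat} (h₁ : SA A₁) (h₂ : SA A₂) (h₃ : SA A₃) (h₄ : SA A₄)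
    (s₁ : A₁ * A₁ = 1) (s₂ : A₂ * A₂ = 1) (s₃ : A₃ * A₃ = 1) (s₄ : A₄ * A₄ = 1)
    (hM : M = A₁ * A₂ * A₃ * A₄) (hSA : SA (M ^ 6)) (h12 : M ^ 6 * M ^ 6 = 1)
    (hne : M ^ 6 ≠ 1) (hne' : M ^ 6 ≠ -1) : M ^ 4 = 1 := by
  have hu := inv_class _ hSA h12
  obtain ⟨p, q, r, y, z, hu, hq⟩ : ∃ p q r y z : K, M ^ 6 = S p q r y z ∧ p^2+q*r-y*z = 1 := by
    rcases hu with h | h | h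
    · exact absurd h hne
    · exact absurd h hne'
    · exact h
  have hDD : D * D = 1 := by decide
  obtain ⟨β, hβ⟩ : ∃ β : K, M ^ 6 * D + D * M ^ 6 = β • 1 := ⟨_, by rw [hu, D, S_anti]⟩
  have hDS : SA D := S_self _ _ _ _ _
  obtain ⟨W, c, hc, hWS, hWW, hWu⟩ : ∃ (W : Mat) (c : K), c ≠ 0 ∧ SA W ∧ W * W = c • 1 ∧
      (W * M ^ 6 = D * W ∨ W * M ^ 6 = -D * W) := by
    have hc : 2 + β ≠ 0 ∨ 2 - β ≠ 0 := by
      clear hβ; revert β; decide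
    generalize M ^ 6 = u at *
    rcases hc with hc | hc
    · refine ⟨u + D, _, hc, ?_, ?_, Or.inl ?_⟩
      · unfold SA at *
        rw [Matrix.transpose_add, add_mul, mul_add, hSA, hDS]
      · rw [add_smul, ← hβ, add_mul, mul_add, mul_add, h12, hDD, two_smul]; abel
      · rw [add_mul, mul_add, h12, hDD]; abel
    · refine ⟨u - D, _, hc, ?_, ?_, Or.inr ?_⟩
      · unfold SA at *
        rw [Matrix.transpose_sub, sub_mul, mul_sub, hSA, hDS]
      · rw [sub_smul, ← hβ, sub_mul, mul_sub, mul_sub, h12, hDD, two_smul]; abel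
      · rw [sub_mul, mul_sub, h12, neg_mul, neg_mul, hDD]; abel
  obtain ⟨U, hU, hUi⟩ : ∃ U : Matˣ, (U : Mat) = W ∧ ((U⁻¹ : Matˣ) : Mat) = c⁻¹ • W :=
    ⟨⟨W, c⁻¹ • W, by rw [mul_smul_comm, hWW, smul_smul, inv_mul_cancel₀ hc, one_smul],
      by rw [smul_mul_assoc, hWW, smul_smul, inv_mul_cancel₀ hc, one_smul]⟩, rfl, rfl⟩
  have hIC : ∀ A : Mat, SA A → A * A = 1 → IC (U * A * (U⁻¹ : Matˣ)) := by
    intro A hA hAA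
    apply inv_class
    · have := hWS.conj hA
      unfold SA at this
      rw [hU, hUi, mul_smul_comm, Matrix.transpose_smul, smul_mul_assoc, this, mul_smul_comm]
    · rw [← pow_two, Units.conj_pow, pow_two, hAA, mul_one, Units.mul_inv]
  have hprod : U * M * (U⁻¹ : Matˣ) = (U * A₁ * (U⁻¹ : Matˣ)) * (U * A₂ * (U⁻¹ : Matˣ)) *
      (U * A₃ * (U⁻¹ : Matˣ)) * (U * A₄ * (U⁻¹ : Matˣ)) := by
    rw [hM]; simp only [mul_assoc, Units.inv_mul_cancel_left]
  have h4 : (U * M * (U⁻¹ : Matˣ)) ^ 4 = 1 := by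
    rw [hprod]
    apply core1 (hIC _ h₁ s₁) (hIC _ h₂ s₂) (hIC _ h₃ s₃) (hIC _ h₄ s₄)
    rw [← hprod, Units.conj_pow, hU]
    rcases hWu with h | h
    · left; rw [h, mul_assoc, ← hU, Units.mul_inv, mul_one]
    · right; rw [h, mul_assoc, ← hU, Units.mul_inv, mul_one]
  rw [Units.conj_pow] at h4
  have : (U⁻¹ : Matˣ) * (U * M ^ 4 * (U⁻¹ : Matˣ)) * U = (U⁻¹ : Matˣ) * 1 * (U : Mat) := by rw [h4]
  simpa only [mul_assoc, Units.inv_mul_cancel_left, Units.inv_mul, mul_one, one_mul] using this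

theorem sa_of_mem {A : Mat} (h : A ∈ Matrix.symplecticGroup (Fin 2) K) (h2 : A * A = 1) : SA A := by
  rw [SymplecticGroup.mem_iff'] at h
  unfold SA
  rw [← mul_one (A.transpose * _), ← h2, ← mul_assoc, h]


theorem transport (F S : Type*) [CommRing F] [CommRing S] (φ : F ≃+* S) :
    ∃ Φ : Matrix (Fin 2 ⊕ Fin 2) (Fin 2 ⊕ Fin 2) F ≃+* Matrix (Fin 2 ⊕ Fin 2) (Fin 2 ⊕ Fin 2) S,
      ∀ A ∈ Matrix.symplecticGroup (Fin 2) F, Φ A ∈ Matrix.symplecticGroup (Fin 2) S := by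
  refine ⟨φ.mapMatrix, fun A hA => ?_⟩
  have h := SymplecticGroup.map_mem hA φ
  have e : φ.mapMatrix A = A.map φ := rfl
  rw [e]
  exact h

theorem equivF (F : Type*) [Field F] (hcard : Nat.card F = 3) : Nonempty (F ≃+* ZMod 3) := by
  have : Finite F := Nat.finite_of_card_ne_zero (by omega)
  have := Fintype.ofFinite F
  have hcard' : Fintype.card F = 3 := by rw [← Nat.card_eq_fintype_card, hcard]
  exact ⟨(ZMod.ringEquivOfPrime F (by norm_num) hcard').symm⟩

open Polynomial in
theorem facts (F : Type*) [Field F] (h3 : (3 : F) = 0) (h2 : (2 : F) ≠ 0)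
    (η : F) (hη : η = 1 ∨ η = -1)
    (M : Matrix (Fin 2 ⊕ Fin 2) (Fin 2 ⊕ Fin 2) F)
    (hmin : minpoly F M = (X ^ 2 + 1) * (X - C η) ^ 2) :
    M ^ 12 = 1 ∧ M ^ 6 ≠ 1 ∧ M ^ 6 ≠ -1 ∧ M ^ 4 ≠ 1 := by
  have h3X : (3 : F[X]) = 0 := by
    rw [← map_ofNat (C : F →+* F[X]) 3, h3, C_0]
  have hηη : η * η = 1 := by rcases hη with rfl | rfl <;> simp
  have hCη : (C η : F[X]) * C η = 1 := by rw [← C_mul, hηη, C_1]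
  -- facts on powers
  have dvd_of : ∀ p : F[X], aeval M p = 0 → (X ^ 2 + 1) * (X - C η) ^ 2 ∣ p := by
    intro p hp; rw [← hmin]; exact minpoly.dvd F M hp
  have h12 : M ^ 12 = 1 := by
    have : (X ^ 12 - 1 : F[X]) = minpoly F M * ((X ^ 2 + 1) ^ 2 * (X - C η) * (X + C η) ^ 3) := by
      have e1 : (X - C η) * (X + C η) = (X ^ 2 - 1 : F[X]) := by linear_combination -hCη
      calc (X ^ 12 - 1 : F[X]) = ((X ^ 2 + 1) * (X ^ 2 - 1)) ^ 3 := by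
            linear_combination (X ^ 8 - X ^ 4) * h3X
        _ = _ := by rw [← e1, hmin]; ring
    have e := congrArg (aeval M) this
    simpa [minpoly.aeval, sub_eq_zero] using e
  have hne' : M ^ 6 ≠ -1 := by
    intro h
    obtain ⟨g, hg⟩ := dvd_of (X ^ 6 + 1) (by simp [h])
    have := congrArg (eval η) hg
    simp at this
    apply h2
    linear_combination this - (η ^ 4 + η ^ 2 + 1) * hηη
  have hne : M ^ 6 ≠ 1 := by
    intro h
    obtain ⟨g, hg⟩ := dvd_of (X ^ 6 - 1) (by simp [h])
    have hd : (X ^ 2 + 1 : F[X]) ∣ C 2 :=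
      ⟨(X ^ 4 - X ^ 2 + 1) - (X - C η) ^ 2 * g, by
        have : (C 2 : F[X]) = 2 := map_ofNat C 2
        rw [this]
        linear_combination -hg⟩
    have hu : IsUnit (X ^ 2 + 1 : F[X]) :=
      isUnit_of_dvd_unit hd (isUnit_C.2 (isUnit_iff_ne_zero.2 h2))
    have hdeg := natDegree_eq_zero_of_isUnit hu
    have : (X ^ 2 + 1 : F[X]).natDegree = 2 := by compute_degree!
    omega
  have hne4 : M ^ 4 ≠ 1 := by
    intro h
    obtain ⟨g, hg⟩ := dvd_of (X ^ 4 - 1) (by simp [h])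
    rw [pow_two (X - C η)] at hg
    have := congrArg (fun p => eval η (derivative p)) hg
    simp at this
    have h4 : (3 + 1 : F) * η ^ 3 = η := by linear_combination η ^ 3 * h3 + η * hηη
    have h0 : η = 0 := by
      rw [← h4]
      simp [this]
    rw [h0] at hηη
    simp at hηη
  exact ⟨h12, hne, hne', hne4⟩

end SpF3

open Polynomial

/-- Let `F` be the field with 3 elements, `η = ±1`, and let `M ∈ Sp_4(F)` have minimal
polynomial `(X² + 1)·(X - η)²`. Then `M` is not a product of four involutions of
`Sp_4(F)`. -/
theorem F3_element_not_product_of_four_involutions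
    (F : Type*) [Field F] (hcard : Nat.card F = 3)
    (η : F) (hη : η = 1 ∨ η = -1)
    (M : Matrix (Fin 2 ⊕ Fin 2) (Fin 2 ⊕ Fin 2) F)
    (hM : M ∈ Matrix.symplecticGroup (Fin 2) F)
    (hmin : minpoly F M = (X ^ 2 + 1) * (X - C η) ^ 2) :
    ¬ ∃ A₁ A₂ A₃ A₄ : Matrix (Fin 2 ⊕ Fin 2) (Fin 2 ⊕ Fin 2) F,
        A₁ ∈ Matrix.symplecticGroup (Fin 2) F ∧
        A₂ ∈ Matrix.symplecticGroup (Fin 2) F ∧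
        A₃ ∈ Matrix.symplecticGroup (Fin 2) F ∧
        A₄ ∈ Matrix.symplecticGroup (Fin 2) F ∧
        A₁ ^ 2 = 1 ∧ A₂ ^ 2 = 1 ∧ A₃ ^ 2 = 1 ∧ A₄ ^ 2 = 1 ∧
        M = A₁ * A₂ * A₃ * A₄ := by
  rintro ⟨A₁, A₂, A₃, A₄, m₁, m₂, m₃, m₄, s₁, s₂, s₃, s₄, hprod⟩
  obtain ⟨φ⟩ := SpF3.equivF F hcard
  have h3 : (3 : F) = 0 := φ.injective (by rw [map_ofNat, map_zero]; decide)
  have h2 : (2 : F) ≠ 0 := fun h => by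
    have := congrArg φ h
    rw [map_ofNat, map_zero] at this
    revert this; decide
  obtain ⟨h12, hne, hne', hne4⟩ := SpF3.facts F h3 h2 η hη M hmin
  -- transport to ZMod 3
  obtain ⟨Φ, hmem⟩ := SpF3.transport F SpF3.K φ
  have hinv : ∀ A, A ^ 2 = 1 → Φ A * Φ A = 1 := by
    intro A hA
    rw [← map_mul, ← pow_two, hA, map_one]
  have h66 : Φ M ^ 6 * Φ M ^ 6 = 1 := by
    have e : M ^ 6 * M ^ 6 = 1 := by rw [← pow_add]; exact h12
    rw [← map_pow, ← map_mul, e, map_one]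
  have q1 := SpF3.sa_of_mem (hmem _ m₁) (hinv _ s₁)
  have q2 : SpF3.SA (Φ M ^ 6) := SpF3.sa_of_mem (pow_mem (hmem _ hM) 6) h66
  have hne2 : Φ M ^ 6 ≠ 1 := by
    intro h
    apply hne
    apply Φ.injective
    rw [map_pow, h, map_one]
  have hne3 : Φ M ^ 6 ≠ -1 := by
    intro h
    apply hne'
    apply Φ.injective
    rw [map_pow, h, map_neg, map_one]
  have hp : Φ M = Φ A₁ * Φ A₂ * Φ A₃ * Φ A₄ := by rw [hprod]; simp only [map_mul]
  have h4 : Φ M ^ 4 = 1 := SpF3.core2 q1 (SpF3.sa_of_mem (hmem _ m₂) (hinv _ s₂))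
    (SpF3.sa_of_mem (hmem _ m₃) (hinv _ s₃)) (SpF3.sa_of_mem (hmem _ m₄) (hinv _ s₄))
    (hinv _ s₁) (hinv _ s₂) (hinv _ s₃) (hinv _ s₄) hp q2 h66 hne2 hne3
  apply hne4
  apply Φ.injective
  rw [map_pow, map_one]
  exact h4
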